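/- There exists a constant C > 0 such that for every ε ∈ (0, 1/2], setting a = 1 − ε, the non-separation probability of the Sticky Brownian Motion rounding satisfies Γ((a+1)/2) / ( Γ((1−a)/2) · Γ(a/2 + 1)² ) · H(a) ≤ (4/π) · ε + C · ε², where H(a) = Σ_{n=0}^∞ (a/2)_n ((a+1)/2)_n² / ( ((a/2)+1)_n² n! ). (Hence a pair of vertices whose SDP vectors make angle θ = (1−ε)π is separated with probability at least 1 − (4/π)ε − O(ε²).) -/

import Mathlib

open Real

/-- Pochhammer symbol (rising factorial): `(c)ₙ = c(c+1)⋯(c+n−1)`, with `(c)₀ = 1`. -/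
noncomputable def poch (c : ℝ) (n : ℕ) : ℝ := ∏ k ∈ Finset.range n, (c + k)

/-- The hypergeometric sum
`H(a) = Σ_{n=0}^∞ (a/2)_n ((a+1)/2)_n² / ( ((a/2)+1)_n² n! )`. -/
noncomputable def H (a : ℝ) : ℝ :=
  ∑' n : ℕ, poch (a / 2) n * (poch ((a + 1) / 2) n) ^ 2 /
    ((poch (a / 2 + 1) n) ^ 2 * (Nat.factorial n))

/-- The `n`-th term of the series defining `H a`. -/
noncomputable def hTerm (a : ℝ) (n : ℕ) : ℝ :=
  poch (a / 2) n * (poch ((a + 1) / 2) n) ^ 2 / ((poch (a / 2 + 1) n) ^ 2 * (Nat.factorial n))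

lemma poch_pos {c : ℝ} (hc : 0 < c) (n : ℕ) : 0 < poch c n :=
  Finset.prod_pos fun k _ => by positivity

lemma poch_succ (c : ℝ) (n : ℕ) : poch c (n + 1) = poch c n * (c + n) :=
  Finset.prod_range_succ _ _

lemma hTerm_nonneg {a : ℝ} (ha : 0 < a) (n : ℕ) : 0 ≤ hTerm a n := by
  have h₁ := poch_pos (c := a / 2) (by positivity) n
  unfold hTerm
  positivity

lemma hTerm_succ {a : ℝ} (ha : 0 < a) (n : ℕ) :
    hTerm a (n + 1) = hTerm a n * ((a / 2 + n) / (a / 2 + 1 + n) *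
      (((a + 1) / 2 + n) / (a / 2 + 1 + n)) * (((a + 1) / 2 + n) / (n + 1))) := by
  have h₁ := (poch_pos (c := a / 2 + 1) (by positivity) n).ne'
  have h₂ : a / 2 + 1 + n ≠ 0 := by positivity
  simp only [hTerm, poch_succ, Nat.factorial_succ]
  push_cast
  field_simp

lemma hTerm_succ_le {a : ℝ} (ha : 0 < a) (ha₁ : a ≤ 1) (n : ℕ) :
    hTerm a (n + 1) ≤ hTerm a n * ((2 * n + 1) * (2 * n + 2) / (2 * n + 3) ^ 2) := by
  have hn : (0 : ℝ) ≤ n := n.cast_nonneg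
  have h₁ : (a / 2 + n) / (a / 2 + 1 + n) ≤ (2 * n + 1) / (2 * n + 3) := by
    rw [div_le_div_iff₀ (by positivity) (by positivity)]
    nlinarith
  have h₂ : ((a + 1) / 2 + n) / (a / 2 + 1 + n) ≤ (2 * n + 2) / (2 * n + 3) := by
    rw [div_le_div_iff₀ (by positivity) (by positivity)]
    nlinarith
  have h₃ : ((a + 1) / 2 + n) / (n + 1) ≤ 1 := by
    rw [div_le_one (by positivity)]
    linarith
  rw [hTerm_succ ha]
  refine mul_le_mul_of_nonneg_left ?_ (hTerm_nonneg ha n)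
  calc _ ≤ (2 * n + 1) / (2 * n + 3) * ((2 * n + 2) / (2 * n + 3)) * (1 : ℝ) := by gcongr
    _ = _ := by field_simp

lemma sum_hTerm_add_le {a : ℝ} (ha : 0 < a) (ha₁ : a ≤ 1) (N : ℕ) :
    ∑ n ∈ Finset.range N, hTerm a n + (2 * N + 2) * hTerm a N ≤ 2 := by
  induction N with
  | zero => simp [hTerm, poch]
  | succ N ih =>
    rw [Finset.sum_range_succ]
    have h₀ := hTerm_nonneg ha N
    have hq : (2 * (N : ℝ) + 4) * ((2 * N + 1) * (2 * N + 2) / (2 * N + 3) ^ 2) ≤ 2 * N + 1 := by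
      rw [← mul_div_assoc, div_le_iff₀ (by positivity)]
      nlinarith [(N.cast_nonneg : (0 : ℝ) ≤ N)]
    have h₁ := mul_le_mul_of_nonneg_left (hTerm_succ_le ha ha₁ N)
      (by positivity : (0 : ℝ) ≤ 2 * N + 4)
    have h₂ := mul_le_mul_of_nonneg_left hq h₀
    push_cast
    linarith

lemma H_le_two {a : ℝ} (ha : 0 < a) (ha₁ : a ≤ 1) : H a ≤ 2 := by
  refine Real.tsum_le_of_sum_range_le (hTerm_nonneg ha) fun N => ?_
  have h₀ := hTerm_nonneg ha N
  have h₁ : 0 ≤ (2 * (N : ℝ) + 2) * hTerm a N := by positivity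
  exact (le_add_of_nonneg_right h₁).trans (sum_hTerm_add_le ha ha₁ N)

/-- A function differentiable on `[0, b]` is bounded above by an affine function
through its value at `0`. -/
lemma exists_le_add_mul_of_differentiableAt {g : ℝ → ℝ} {b : ℝ}
    (hg : ∀ x ∈ Set.Icc 0 b, DifferentiableAt ℝ g x) :
    ∃ C : ℝ, 0 < C ∧ ∀ x ∈ Set.Icc 0 b, g x ≤ g 0 + C * x := by
  have hc : ContinuousOn (dslope g 0) (Set.Icc 0 b) := fun x hx => by
    rcases eq_or_ne x 0 with rfl | hx₀
    · exact (continuousAt_dslope_same.2 (hg 0 hx)).continuousWithinAt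
    · exact ((continuousAt_dslope_of_ne hx₀).2 (hg x hx).continuousAt).continuousWithinAt
  obtain ⟨C, hC⟩ := isCompact_Icc.exists_bound_of_continuousOn hc
  refine ⟨|C| + 1, by positivity, fun x hx => ?_⟩
  have h₁ : dslope g 0 x ≤ |C| + 1 := by
    linarith [le_abs_self (dslope g 0 x), Real.norm_eq_abs (dslope g 0 x), hC x hx, le_abs_self C]
  have h₂ : x * dslope g 0 x = g x - g 0 := by simpa using sub_smul_dslope g 0 x
  nlinarith [mul_le_mul_of_nonneg_left h₁ hx.1]

/-- The prefactor of `H (1 - ε)` divided by its leading behaviour `ε / 2`. -/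
noncomputable def gammaRatio (ε : ℝ) : ℝ :=
  Gamma (1 - ε / 2) / (Gamma (1 + ε / 2) * Gamma (3 / 2 - ε / 2) ^ 2)

lemma gammaRatio_zero : gammaRatio 0 = 4 / π := by
  have h : Gamma (3 / 2) = √π / 2 := by
    rw [show (3 / 2 : ℝ) = 1 / 2 + 1 by norm_num, Gamma_add_one (by norm_num), Gamma_one_half_eq]
    ring
  simp only [gammaRatio, zero_div, sub_zero, add_zero, Gamma_one, h, div_pow, sq_sqrt pi_pos.le]
  field_simp
  norm_num

lemma differentiableAt_Gamma_of_pos {x : ℝ} (hx : 0 < x) : DifferentiableAt ℝ Gamma x :=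
  differentiableAt_Gamma fun m => by
    have : (0 : ℝ) ≤ m := m.cast_nonneg
    linarith

lemma differentiableAt_gammaRatio {x : ℝ} (hx : x ∈ Set.Icc (0 : ℝ) (1 / 2)) :
    DifferentiableAt ℝ gammaRatio x := by
  obtain ⟨h₀, h₁⟩ := hx
  have p₂ : 0 < Gamma (1 + x / 2) := Gamma_pos_of_pos (by linarith)
  have p₃ : 0 < Gamma (3 / 2 - x / 2) := Gamma_pos_of_pos (by linarith)
  have d₁ : DifferentiableAt ℝ (fun y : ℝ => Gamma (1 - y / 2)) x :=
    DifferentiableAt.fun_comp' x (differentiableAt_Gamma_of_pos (by linarith)) (by fun_prop)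
  have d₂ : DifferentiableAt ℝ (fun y : ℝ => Gamma (1 + y / 2)) x :=
    DifferentiableAt.fun_comp' x (differentiableAt_Gamma_of_pos (by linarith)) (by fun_prop)
  have d₃ : DifferentiableAt ℝ (fun y : ℝ => Gamma (3 / 2 - y / 2)) x :=
    DifferentiableAt.fun_comp' x (differentiableAt_Gamma_of_pos (by linarith)) (by fun_prop)
  exact d₁.div (d₂.mul (d₃.pow 2)) (by positivity)

theorem stmt7 :
    ∃ C : ℝ, 0 < C ∧ ∀ ε : ℝ, ε ∈ Set.Ioc (0 : ℝ) (1 / 2) → ∀ a : ℝ, a = 1 - ε →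
      Real.Gamma ((a + 1) / 2) /
          (Real.Gamma ((1 - a) / 2) * (Real.Gamma (a / 2 + 1)) ^ 2) * H a ≤
        4 / π * ε + C * ε ^ 2 := by
  obtain ⟨C, hC, hle⟩ := exists_le_add_mul_of_differentiableAt
    fun x hx => differentiableAt_gammaRatio hx
  refine ⟨C, hC, ?_⟩
  rintro ε ⟨h₀, h₁⟩ a rfl
  have hg := hle ε ⟨h₀.le, h₁⟩
  rw [gammaRatio_zero] at hg
  have p₁ : 0 < Gamma (1 - ε / 2) := Gamma_pos_of_pos (by linarith)
  have p₂ : 0 < Gamma (1 + ε / 2) := Gamma_pos_of_pos (by linarith)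
  have p₃ : 0 < Gamma (3 / 2 - ε / 2) := Gamma_pos_of_pos (by linarith)
  have hΓ : Gamma (1 + ε / 2) = ε / 2 * Gamma (ε / 2) := by
    rw [add_comm, Gamma_add_one (by positivity)]
  have hpre : Gamma ((1 - ε + 1) / 2) /
      (Gamma ((1 - (1 - ε)) / 2) * Gamma ((1 - ε) / 2 + 1) ^ 2) = ε / 2 * gammaRatio ε := by
    have p₄ : 0 < Gamma (ε / 2) := Gamma_pos_of_pos (by linarith)
    rw [show (1 - ε + 1) / 2 = 1 - ε / 2 by ring, show (1 - (1 - ε)) / 2 = ε / 2 by ring,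
      show (1 - ε) / 2 + 1 = 3 / 2 - ε / 2 by ring, gammaRatio, hΓ]
    field_simp
  have hpos : 0 ≤ gammaRatio ε := by
    unfold gammaRatio
    positivity
  rw [hpre]
  calc ε / 2 * gammaRatio ε * H (1 - ε) ≤ ε / 2 * gammaRatio ε * 2 := by
        gcongr
        exact H_le_two (by linarith) (by linarith)
    _ = ε * gammaRatio ε := by ring
    _ ≤ ε * (4 / π + C * ε) := by gcongr
    _ = 4 / π * ε + C * ε ^ 2 := by ring
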